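/- (Additivity of spectral numbers under tensor product of filtered complexes) Let (C⁰, δ⁰, v⁰) and (C¹, δ¹, v¹) be finitely generated filtered chain complexes over the downward Novikov field Λ as above, and let (C, δ, v) = (C⁰ ⊗_Λ C¹, δ⁰⊗1 ± 1⊗δ¹, v) with v(x⁰ ⊗ x¹) = v⁰(x⁰) + v¹(x¹) on pure tensors of basis elements. Then for nonzero homology classes a⁰ ∈ H(C⁰), a¹ ∈ H(C¹), the spectral number of the Künneth class satisfies c(a⁰ ⊗ a¹) = c⁰(a⁰) + c¹(a¹). -/

import Mathlib

/-- The downward universal Novikov ring over `R`: formal sums `Σ aᵢ q^{wᵢ}` with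
`wᵢ → -∞`, modelled as Hahn series over `ℝᵒᵈ`. -/
noncomputable abbrev Novikov (R : Type*) [Zero R] : Type _ := HahnSeries ℝᵒᵈ R

/-- The valuation `v_q` on the downward Novikov ring: the supremum of the exponents
appearing with nonzero coefficient, with `v_q 0 = ⊥` (i.e. `-∞`). -/
noncomputable def vq {R : Type*} [Zero R] (x : Novikov R) : WithBot ℝ :=
  letI := Classical.dec (x = 0)
  if x = 0 then ⊥ else ((OrderDual.ofDual x.order : ℝ) : WithBot ℝ)

/-- The valuation `v_q` with values in `EReal` (`v_q 0 = -∞`). -/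
noncomputable def vqE {R : Type*} [Zero R] (x : Novikov R) : EReal :=
  letI := Classical.dec (x = 0)
  if x = 0 then ⊥ else ((OrderDual.ofDual x.order : ℝ) : EReal)

/-- The valuation on a finitely generated free module over the Novikov ring, with
fixed action values `A i` of the basis elements. -/
noncomputable def chainVal {R : Type*} [Zero R] {ι : Type*} [Fintype ι] (A : ι → ℝ)
    (X : ι → Novikov R) : EReal :=
  ⨆ i : ι, (vqE (X i) + ((A i : ℝ) : EReal))

/-- The tensor product of chains: `(x ⊗ y) (i,j) = x i * y j`. -/
noncomputable def tensChain {R : Type*} [NonUnitalNonAssocSemiring R] {N0 N1 : ℕ}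
    (x : Fin N0 → Novikov R) (y : Fin N1 → Novikov R) :
    Fin N0 × Fin N1 → Novikov R :=
  fun p => x p.1 * y p.2

theorem vqE_zero_eq {K : Type*} [Field K] : vqE (0 : Novikov K) = ⊥ := by simp [vqE]

theorem vqE_of_ne {K : Type*} [Field K] {x : Novikov K} (h : x ≠ 0) :
    vqE x = ((OrderDual.ofDual x.order : ℝ) : EReal) := by simp [vqE, h]

theorem vqE_mul_eq {K : Type*} [Field K] (x y : Novikov K) : vqE (x * y) = vqE x + vqE y := by
  by_cases hx : x = 0
  · simp [hx, vqE_zero_eq]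
  by_cases hy : y = 0
  · simp [hy, vqE_zero_eq]
  rw [vqE_of_ne hx, vqE_of_ne hy, vqE_of_ne (mul_ne_zero hx hy), HahnSeries.order_mul hx hy]
  simp

theorem vqE_sub_le {K : Type*} [Field K] (x y : Novikov K) :
    vqE (x - y) ≤ max (vqE x) (vqE y) := by
  by_cases hx : x = 0
  · by_cases hy : y = 0
    · simp [hx, hy]
    · subst hx
      rw [zero_sub, vqE_of_ne hy, vqE_of_ne (neg_ne_zero.2 hy), HahnSeries.order_neg]
      exact le_max_right _ _
  by_cases hy : y = 0
  · simp [hy]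
  by_cases h : x - y = 0
  · simp [h, vqE_zero_eq]
  rw [vqE_of_ne hx, vqE_of_ne hy, vqE_of_ne h]
  have h1 : x + (-y) ≠ 0 := by rwa [← sub_eq_add_neg]
  have := HahnSeries.min_order_le_order_add h1
  rw [HahnSeries.order_neg, ← sub_eq_add_neg] at this
  rcases min_le_iff.1 this with h2 | h2
  · exact le_max_of_le_left (EReal.coe_le_coe_iff.2 h2)
  · exact le_max_of_le_right (EReal.coe_le_coe_iff.2 h2)

theorem le_chainVal {K : Type*} [Field K] {ι : Type*} [Fintype ι] (A : ι → ℝ)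
    (X : ι → Novikov K) (i : ι) : vqE (X i) + ((A i : ℝ) : EReal) ≤ chainVal A X :=
  le_iSup (fun i => vqE (X i) + ((A i : ℝ) : EReal)) i

theorem chainVal_le {K : Type*} [Field K] {ι : Type*} [Fintype ι] (A : ι → ℝ)
    (X : ι → Novikov K) (c : EReal) (h : ∀ i, vqE (X i) + ((A i : ℝ) : EReal) ≤ c) :
    chainVal A X ≤ c := iSup_le h

theorem exists_chainVal {K : Type*} [Field K] {ι : Type*} [Fintype ι] [Nonempty ι] (A : ι → ℝ)
    (X : ι → Novikov K) : ∃ i, vqE (X i) + ((A i : ℝ) : EReal) = chainVal A X :=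
  exists_eq_ciSup_of_finite

/-- A filtration-nonincreasing linear map killing exactly `V`, the identity modulo `V`. -/
theorem exists_proj {K : Type*} [Field K] {ι : Type*} [Fintype ι] [Nonempty ι] (A : ι → ℝ)
    (V : Submodule (Novikov K) (ι → Novikov K)) :
    ∃ P : (ι → Novikov K) →ₗ[Novikov K] (ι → Novikov K),
      (∀ v ∈ V, P v = 0) ∧ (∀ x, P x - x ∈ V) ∧ ∀ x, chainVal A (P x) ≤ chainVal A x := by
  induction V using WellFoundedLT.induction with
  | ind V ih =>
  by_cases hV : V = ⊥
  · subst hV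
    exact ⟨LinearMap.id, by simp, by simp, by simp⟩
  obtain ⟨v, hv, hv0⟩ := (Submodule.ne_bot_iff V).1 hV
  obtain ⟨i, hi⟩ := exists_chainVal A v
  have hvi : v i ≠ 0 := by
    intro h
    apply hv0
    funext j
    by_contra hj
    have h1 := le_chainVal A v j
    rw [← hi, h, vqE_zero_eq, EReal.bot_add, vqE_of_ne hj, ← EReal.coe_add] at h1
    exact absurd h1 (by simp)
  let P1 : (ι → Novikov K) →ₗ[Novikov K] (ι → Novikov K) :=
    LinearMap.id - ((v i)⁻¹ • LinearMap.proj (R := Novikov K) (φ := fun _ : ι => Novikov K) i).smulRight v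
  have hP1 : ∀ x, P1 x = x - ((v i)⁻¹ * x i) • v := fun x => rfl
  have hsub : ∀ x, P1 x - x ∈ V := by
    intro x
    rw [hP1, sub_sub_cancel_left]
    exact V.neg_mem (V.smul_mem _ hv)
  have hle : V.map P1 ≤ V := by
    rintro _ ⟨x, hx, rfl⟩
    have := V.add_mem (hsub x) hx
    simpa using this
  have hlt : V.map P1 < V := by
    refine lt_of_le_of_ne hle ?_
    intro h
    rw [← h] at hv
    obtain ⟨x, _, hx⟩ := hv
    apply hvi
    rw [← hx, hP1]
    simp only [Pi.sub_apply, Pi.smul_apply, smul_eq_mul]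
    field_simp
    simp
  obtain ⟨Q, h1, h2, h3⟩ := ih _ hlt
  refine ⟨Q ∘ₗ P1, ?_, ?_, ?_⟩
  · intro w hw
    exact h1 _ ⟨w, hw, rfl⟩
  · intro x
    have := V.add_mem (hle (h2 (P1 x))) (hsub x)
    simpa using this
  · intro x
    refine (h3 _).trans ?_
    apply chainVal_le
    intro j
    have e1 := le_chainVal A x j
    have e2 : vqE ((v i)⁻¹ * x i * v j) + ((A j : ℝ) : EReal) ≤ chainVal A x := by
      have e3 := le_chainVal A v j
      rw [← hi] at e3
      calc vqE ((v i)⁻¹ * x i * v j) + ((A j : ℝ) : EReal)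
          = vqE ((v i)⁻¹ * x i) + (vqE (v j) + ((A j : ℝ) : EReal)) := by
            rw [vqE_mul_eq, add_assoc]
        _ ≤ vqE ((v i)⁻¹ * x i) + (vqE (v i) + ((A i : ℝ) : EReal)) := by gcongr
        _ = vqE (x i) + ((A i : ℝ) : EReal) := by
            rw [← add_assoc, ← vqE_mul_eq]
            congr 2
            field_simp
        _ ≤ _ := le_chainVal A x i
    have e4 : vqE (P1 x j) ≤ max (vqE (x j)) (vqE ((v i)⁻¹ * x i * v j)) := by
      rw [hP1]
      exact vqE_sub_le _ _
    rcases le_max_iff.1 e4 with e | e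
    · exact (add_le_add_left e _).trans e1
    · exact (add_le_add_left e _).trans e2

theorem key_functional {K : Type*} [Field K] {ι : Type*} [Fintype ι] (A : ι → ℝ)
    (δ : (ι → Novikov K) →ₗ[Novikov K] (ι → Novikov K)) (Z : ι → Novikov K)
    (hnz : ∀ Y, Z ≠ δ Y) :
    ∃ (f : (ι → Novikov K) →ₗ[Novikov K] Novikov K) (i : ι) (Y : ι → Novikov K),
      (∀ x, f (δ x) = 0) ∧ (∀ x, vqE (f x) + ((A i : ℝ) : EReal) ≤ chainVal A x) ∧
      chainVal A (Z + δ Y) = vqE (f Z) + ((A i : ℝ) : EReal) := by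
  have : Nonempty ι := by
    by_contra h
    rw [not_nonempty_iff] at h
    exact hnz 0 (Subsingleton.elim _ _)
  obtain ⟨P, h1, h2, h3⟩ := exists_proj A (LinearMap.range δ)
  obtain ⟨i, hi⟩ := exists_chainVal A (P Z)
  obtain ⟨Y, hY⟩ := h2 Z
  refine ⟨LinearMap.proj i ∘ₗ P, i, Y, ?_, ?_, ?_⟩
  · intro x
    simp [h1 (δ x) ⟨x, rfl⟩]
  · intro x
    exact (le_chainVal A (P x) i).trans (h3 x)
  · rw [hY, add_sub_cancel]
    exact hi.symm

theorem key_inf {K : Type*} [Field K] {ι : Type*} [Fintype ι] (A : ι → ℝ)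
    (δ : (ι → Novikov K) →ₗ[Novikov K] (ι → Novikov K)) (Z : ι → Novikov K)
    (f : (ι → Novikov K) →ₗ[Novikov K] Novikov K) (i : ι) (Y : ι → Novikov K)
    (h1 : ∀ x, f (δ x) = 0) (h2 : ∀ x, vqE (f x) + ((A i : ℝ) : EReal) ≤ chainVal A x)
    (h3 : chainVal A (Z + δ Y) = vqE (f Z) + ((A i : ℝ) : EReal)) :
    (⨅ Y, chainVal A (Z + δ Y)) = vqE (f Z) + ((A i : ℝ) : EReal) := by
  apply le_antisymm
  · rw [← h3]
    exact iInf_le _ Y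
  · refine le_iInf fun W => ?_
    have := h2 (Z + δ W)
    rwa [map_add, h1, add_zero] at this

noncomputable def tensBil (K : Type*) [Field K] (N0 N1 : ℕ) :
    (Fin N0 → Novikov K) →ₗ[Novikov K] (Fin N1 → Novikov K) →ₗ[Novikov K]
      (Fin N0 × Fin N1 → Novikov K) :=
  LinearMap.mk₂ (Novikov K) tensChain
    (fun x y z => by funext p; simp [tensChain, add_mul])
    (fun c x y => by funext p; simp [tensChain, mul_assoc])
    (fun x y z => by funext p; simp [tensChain, mul_add])
    (fun c x y => by funext p; simp [tensChain, mul_left_comm])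

noncomputable def sgnMap (K : Type*) [Field K] {N0 : ℕ} (deg : Fin N0 → ℕ) :
    (Fin N0 → Novikov K) →ₗ[Novikov K] (Fin N0 → Novikov K) :=
  LinearMap.pi fun i => ((-1 : Novikov K) ^ deg i) •
    LinearMap.proj (R := Novikov K) (φ := fun _ : Fin N0 => Novikov K) i

theorem sgnMap_single {K : Type*} [Field K] {N0 : ℕ} (deg : Fin N0 → ℕ) (i : Fin N0) :
    sgnMap K deg (Pi.single i 1) = ((-1 : Novikov K) ^ deg i) • Pi.single i 1 := by
  funext j
  by_cases h : j = i
  · subst h; simp [sgnMap]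
  · simp [sgnMap, h]

theorem δ_tens {K : Type*} [Field K] {N0 N1 : ℕ} (deg : Fin N0 → ℕ)
    (δ0 : (Fin N0 → Novikov K) →ₗ[Novikov K] (Fin N0 → Novikov K))
    (δ1 : (Fin N1 → Novikov K) →ₗ[Novikov K] (Fin N1 → Novikov K))
    (δ : (Fin N0 × Fin N1 → Novikov K) →ₗ[Novikov K] (Fin N0 × Fin N1 → Novikov K))
    (hδ : ∀ (i : Fin N0) (j : Fin N1),
      δ (tensChain (Pi.single i (1 : Novikov K)) (Pi.single j (1 : Novikov K))) =
        tensChain (δ0 (Pi.single i 1)) (Pi.single j 1) +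
          ((-1 : Novikov K) ^ (deg i)) •
            tensChain (Pi.single i 1) (δ1 (Pi.single j 1)))
    (x : Fin N0 → Novikov K) (y : Fin N1 → Novikov K) :
    δ (tensChain x y) = tensChain (δ0 x) y + tensChain (sgnMap K deg x) (δ1 y) := by
  have H : (tensBil K N0 N1).compr₂ δ =
      (tensBil K N0 N1) ∘ₗ δ0 + (tensBil K N0 N1).compl₁₂ (sgnMap K deg) δ1 := by
    refine (Pi.basisFun (Novikov K) (Fin N0)).ext fun i => ?_
    refine (Pi.basisFun (Novikov K) (Fin N1)).ext fun j => ?_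
    simp only [Pi.basisFun_apply, LinearMap.compr₂_apply, LinearMap.add_apply,
      LinearMap.comp_apply, LinearMap.compl₁₂_apply, sgnMap_single, map_smul,
      LinearMap.smul_apply]
    exact hδ i j
  exact congrArg (fun B => B x y) H

noncomputable def tensFun {K : Type*} [Field K] {N0 N1 : ℕ}
    (f0 : (Fin N0 → Novikov K) →ₗ[Novikov K] Novikov K)
    (f1 : (Fin N1 → Novikov K) →ₗ[Novikov K] Novikov K) :
    (Fin N0 × Fin N1 → Novikov K) →ₗ[Novikov K] Novikov K :=
  f0 ∘ₗ LinearMap.pi fun i => f1 ∘ₗ LinearMap.funLeft (Novikov K) (Novikov K) fun j => (i, j)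

theorem tensFun_apply {K : Type*} [Field K] {N0 N1 : ℕ}
    (f0 : (Fin N0 → Novikov K) →ₗ[Novikov K] Novikov K)
    (f1 : (Fin N1 → Novikov K) →ₗ[Novikov K] Novikov K) (X : Fin N0 × Fin N1 → Novikov K) :
    tensFun f0 f1 X = f0 fun i => f1 fun j => X (i, j) := rfl

theorem tensFun_tens {K : Type*} [Field K] {N0 N1 : ℕ}
    (f0 : (Fin N0 → Novikov K) →ₗ[Novikov K] Novikov K)
    (f1 : (Fin N1 → Novikov K) →ₗ[Novikov K] Novikov K)
    (x : Fin N0 → Novikov K) (y : Fin N1 → Novikov K) :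
    tensFun f0 f1 (tensChain x y) = f0 x * f1 y := by
  rw [tensFun_apply]
  have h : (fun i => f1 fun j => tensChain x y (i, j)) = f1 y • x := by
    funext i
    have : (fun j => tensChain x y (i, j)) = x i • y := rfl
    rw [this, map_smul]
    simp [mul_comm]
  rw [h, map_smul, smul_eq_mul, mul_comm]

theorem single_tens {K : Type*} [Field K] {N0 N1 : ℕ} (i : Fin N0) (j : Fin N1) :
    (Pi.single (i, j) 1 : Fin N0 × Fin N1 → Novikov K) =
      tensChain (Pi.single i 1) (Pi.single j 1) := by
  funext p
  obtain ⟨a, b⟩ := p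
  by_cases ha : a = i <;> by_cases hb : b = j <;>
    simp [tensChain, Pi.single_apply, ha, hb]

/-- Additivity of spectral numbers under tensor product of filtered complexes
(Entov–Polterovich): for the Künneth product complex
`(C⁰ ⊗ C¹, δ⁰⊗1 ± 1⊗δ¹)` over the downward Novikov field, with the product valuation
determined by `A(i,j) = A⁰(i) + A¹(j)`, the spectral number of the product of two
nonzero homology classes is the sum of the spectral numbers. -/
theorem spectral_number_kunneth_additive
    (K : Type*) [Field K] (N0 N1 : ℕ)
    (A0 : Fin N0 → ℝ) (A1 : Fin N1 → ℝ) (deg : Fin N0 → ℕ)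
    (δ0 : (Fin N0 → Novikov K) →ₗ[Novikov K] (Fin N0 → Novikov K))
    (δ1 : (Fin N1 → Novikov K) →ₗ[Novikov K] (Fin N1 → Novikov K))
    (hδ02 : ∀ X, δ0 (δ0 X) = 0) (hδ12 : ∀ X, δ1 (δ1 X) = 0)
    (hfilt0 : ∀ X, chainVal A0 (δ0 X) ≤ chainVal A0 X)
    (hfilt1 : ∀ X, chainVal A1 (δ1 X) ≤ chainVal A1 X)
    (δ : (Fin N0 × Fin N1 → Novikov K) →ₗ[Novikov K] (Fin N0 × Fin N1 → Novikov K))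
    -- `δ = δ⁰ ⊗ 1 ± 1 ⊗ δ¹`, with the Koszul sign determined by the degree
    (hδ : ∀ (i : Fin N0) (j : Fin N1),
      δ (tensChain (Pi.single i (1 : Novikov K)) (Pi.single j (1 : Novikov K))) =
        tensChain (δ0 (Pi.single i 1)) (Pi.single j 1) +
          ((-1 : Novikov K) ^ (deg i)) •
            tensChain (Pi.single i 1) (δ1 (Pi.single j 1)))
    (hfilt : ∀ X, chainVal (fun p : Fin N0 × Fin N1 => A0 p.1 + A1 p.2) (δ X) ≤
      chainVal (fun p : Fin N0 × Fin N1 => A0 p.1 + A1 p.2) X)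
    (Z0 : Fin N0 → Novikov K) (hZ0 : δ0 Z0 = 0) (hnz0 : ∀ Y, Z0 ≠ δ0 Y)
    (hhom : ∃ k, ∀ i, Z0 i ≠ 0 → deg i = k)
    (Z1 : Fin N1 → Novikov K) (hZ1 : δ1 Z1 = 0) (hnz1 : ∀ Y, Z1 ≠ δ1 Y)
    (hcycle : δ (tensChain Z0 Z1) = 0) :
    (⨅ W : Fin N0 × Fin N1 → Novikov K,
        chainVal (fun p : Fin N0 × Fin N1 => A0 p.1 + A1 p.2) (tensChain Z0 Z1 + δ W)) =
      (⨅ Y : Fin N0 → Novikov K, chainVal A0 (Z0 + δ0 Y)) +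
        (⨅ Y : Fin N1 → Novikov K, chainVal A1 (Z1 + δ1 Y)) := by
  have hT := δ_tens deg δ0 δ1 δ hδ
  obtain ⟨f0, i0, Y0, a1, a2, a3⟩ := key_functional A0 δ0 Z0 hnz0
  obtain ⟨f1, i1, Y1, b1, b2, b3⟩ := key_functional A1 δ1 Z1 hnz1
  rw [key_inf A0 δ0 Z0 f0 i0 Y0 a1 a2 a3, key_inf A1 δ1 Z1 f1 i1 Y1 b1 b2 b3]
  apply le_antisymm
  · obtain ⟨k, hk⟩ := hhom
    have hS : sgnMap K deg Z0 = ((-1 : Novikov K) ^ k) • Z0 := by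
      funext i
      by_cases h : Z0 i = 0
      · simp [sgnMap, h]
      · simp [sgnMap, hk i h]
    have hS2 : sgnMap K deg (((-1 : Novikov K) ^ k) • Z0) = Z0 := by
      rw [map_smul, hS, smul_smul, ← pow_add, Even.neg_one_pow ⟨k, rfl⟩, one_smul]
    refine (iInf_le _ (tensChain (((-1 : Novikov K) ^ k) • Z0) Y1 +
      tensChain Y0 (Z1 + δ1 Y1))).trans ?_
    have e : tensChain Z0 Z1 + δ (tensChain (((-1 : Novikov K) ^ k) • Z0) Y1 +
        tensChain Y0 (Z1 + δ1 Y1)) = tensChain (Z0 + δ0 Y0) (Z1 + δ1 Y1) := by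
      rw [map_add, hT, hT, hS2, map_smul, hZ0, map_add δ1, hZ1, hδ12]
      funext p
      simp only [tensChain, Pi.add_apply, Pi.smul_apply, Pi.zero_apply, smul_zero]
      ring
    rw [e, ← a3, ← b3]
    apply chainVal_le
    intro p
    have e1 := le_chainVal A0 (Z0 + δ0 Y0) p.1
    have e2 := le_chainVal A1 (Z1 + δ1 Y1) p.2
    refine le_trans (le_of_eq ?_) (add_le_add e1 e2)
    rw [tensChain, vqE_mul_eq, EReal.coe_add, add_add_add_comm]
  · refine le_iInf fun W => ?_
    have hFδ : (tensFun f0 f1) ∘ₗ δ = 0 := by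
      refine (Pi.basisFun (Novikov K) (Fin N0 × Fin N1)).ext fun p => ?_
      obtain ⟨i, j⟩ := p
      rw [Pi.basisFun_apply, LinearMap.comp_apply, single_tens, hT, map_add, tensFun_tens,
        tensFun_tens, a1, b1]
      simp
    have hF : tensFun f0 f1 (tensChain Z0 Z1 + δ W) = f0 Z0 * f1 Z1 := by
      have h := LinearMap.congr_fun hFδ W
      rw [LinearMap.comp_apply, LinearMap.zero_apply] at h
      rw [map_add, h, add_zero, tensFun_tens]
    generalize tensChain Z0 Z1 + δ W = X at hF
    have : Nonempty (Fin N0) := ⟨i0⟩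
    rw [add_add_add_comm, ← vqE_mul_eq, ← hF, tensFun_apply, ← add_assoc]
    have c1 := a2 (fun i => f1 fun j => X (i, j))
    obtain ⟨i, hi⟩ := exists_chainVal A0 (fun i => f1 fun j => X (i, j))
    rw [← hi] at c1
    refine (add_le_add_left c1 _).trans ?_
    have c2 := b2 (fun j => X (i, j))
    have : Nonempty (Fin N1) := ⟨i1⟩
    obtain ⟨j, hj⟩ := exists_chainVal A1 (fun j => X (i, j))
    rw [← hj] at c2
    rw [add_right_comm]
    refine (add_le_add_left c2 _).trans ?_
    have c3 := le_chainVal (fun p : Fin N0 × Fin N1 => A0 p.1 + A1 p.2) X (i, j)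
    refine le_trans (le_of_eq ?_) c3
    rw [EReal.coe_add, add_assoc, add_comm ((A1 j : ℝ) : EReal)]
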